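/- arXiv:math/0305441 — 2 statements merged into one kernel-verified Lean document; each statement's English description precedes it below -/
import Mathlib

section
/- If P is a finitely generated saturated commutative cancellative monoid, then P is isomorphic to the direct sum P^* ⊕ P̄ of its unit group and its sharp quotient. -/
/-- The unit group `P^*` of a submonoid `P` of an abelian group `G`. -/
def AddSubmonoid.unitGroup {G : Type*} [AddCommGroup G] (P : AddSubmonoid G) :
    AddSubgroup G where
  carrier := {g | g ∈ P ∧ -g ∈ P}
  zero_mem' := ⟨P.zero_mem, by simpa using P.zero_mem⟩
  add_mem' := fun {a b} ha hb =>
    ⟨P.add_mem ha.1 hb.1, by rw [neg_add]; exact P.add_mem ha.2 hb.2⟩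
  neg_mem' := fun {a} ha => ⟨ha.2, by simpa using ha.1⟩

/-- If `P` is a finitely generated saturated commutative cancellative monoid (realized as a
submonoid of its Grothendieck group `G`), then `P` is isomorphic to the direct sum
`P^* ⊕ P̄` of its unit group and its sharp quotient (the image of `P` in `G/P^*`). -/
theorem fg_saturated_splits {G : Type*} [AddCommGroup G] (P : AddSubmonoid G)
    (hfg : P.FG)
    (hgen : ∀ g : G, ∃ p ∈ P, ∃ q ∈ P, g = p - q)
    (hsat : ∀ (n : ℕ) (g : G), 0 < n → n • g ∈ P → g ∈ P) :
    Nonempty (P ≃+ (P.unitGroup × P.map (QuotientAddGroup.mk' P.unitGroup))) := by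
  classical
  have hG : AddGroup.FG G := by
    obtain ⟨S, hS⟩ := hfg
    refine ⟨⟨S, ?_⟩⟩
    rw [eq_top_iff]
    have hle : ∀ p ∈ P, p ∈ AddSubgroup.closure (S : Set G) := by
      intro p hp
      rw [← hS] at hp
      exact (AddSubmonoid.closure_le (S := (AddSubgroup.closure (S : Set G)).toAddSubmonoid)).2
        AddSubgroup.subset_closure hp
    rintro g -
    obtain ⟨p, hp, q, hq, rfl⟩ := hgen g
    exact sub_mem (hle p hp) (hle q hq)
  have hfin : Module.Finite ℤ (G ⧸ P.unitGroup) := by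
    have : Module.Finite ℤ G := Module.Finite.iff_addGroup_fg.2 hG
    exact Module.Finite.of_surjective (QuotientAddGroup.mk' P.unitGroup).toIntLinearMap
      (QuotientAddGroup.mk'_surjective _)
  have hnat : ∀ (n : ℕ) (x : G ⧸ P.unitGroup), 0 < n → n • x = 0 → x = 0 := by
    intro n x hn hx
    induction x using QuotientAddGroup.induction_on with
    | H g =>
      rw [← QuotientAddGroup.mk_nsmul, QuotientAddGroup.eq_zero_iff] at hx
      rw [QuotientAddGroup.eq_zero_iff]
      refine ⟨hsat n g hn hx.1, hsat n (-g) hn ?_⟩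
      rw [smul_neg]
      exact hx.2
  have htf : Module.IsTorsionFree ℤ (G ⧸ P.unitGroup) := by
    have : IsAddTorsionFree (G ⧸ P.unitGroup) := by
      refine ⟨fun n hn a b hab => ?_⟩
      have h := hnat n (a - b) (Nat.pos_of_ne_zero hn) (by
        rw [smul_sub]; exact sub_eq_zero.2 hab)
      exact sub_eq_zero.1 h
    infer_instance
  have hfree : Module.Free ℤ (G ⧸ P.unitGroup) := inferInstance
  obtain ⟨s, hs⟩ := Module.projective_lifting_property
    (QuotientAddGroup.mk' P.unitGroup).toIntLinearMap LinearMap.id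
      (QuotientAddGroup.mk'_surjective _)
  have hs' : ∀ x, QuotientAddGroup.mk' P.unitGroup (s x) = x := fun x => LinearMap.congr_fun hs x
  have hU : ∀ g : G, g - s (QuotientAddGroup.mk' P.unitGroup g) ∈ P.unitGroup := by
    intro g
    rw [← QuotientAddGroup.eq_zero_iff]
    change QuotientAddGroup.mk' P.unitGroup _ = 0
    rw [map_sub, hs', sub_self]
  have hsP : ∀ x ∈ P.map (QuotientAddGroup.mk' P.unitGroup), s x ∈ P := by
    rintro _ ⟨p, hp, rfl⟩
    have := P.add_mem hp (hU p).2
    simpa using this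
  have hu0 : ∀ u ∈ P.unitGroup, QuotientAddGroup.mk' P.unitGroup u = 0 := fun u hu =>
    (QuotientAddGroup.eq_zero_iff u).2 hu
  exact ⟨{
    toFun := fun p => (⟨_, hU p⟩, ⟨_, AddSubmonoid.mem_map_of_mem _ p.2⟩)
    invFun := fun y => ⟨y.1 + s y.2, P.add_mem y.1.2.1 (hsP _ y.2.2)⟩
    left_inv := fun p => Subtype.ext (sub_add_cancel _ _)
    right_inv := by
      rintro ⟨⟨u, hu⟩, ⟨x, hx⟩⟩
      have h : QuotientAddGroup.mk' P.unitGroup (u + s x) = x := by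
        rw [map_add, hs', hu0 u hu, zero_add]
      refine Prod.ext (Subtype.ext ?_) (Subtype.ext h)
      change u + s x - s (QuotientAddGroup.mk' P.unitGroup (u + s x)) = u
      rw [h, add_sub_cancel_right]
    map_add' := by
      rintro ⟨p, hp⟩ ⟨q, hq⟩
      refine Prod.ext (Subtype.ext ?_) (Subtype.ext (map_add _ p q))
      change p + q - s (QuotientAddGroup.mk' P.unitGroup (p + q)) =
        (p - s (QuotientAddGroup.mk' P.unitGroup p)) + (q - s (QuotientAddGroup.mk' P.unitGroup q))
      rw [map_add, map_add]
      abel }⟩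
end

section
/- Let P be a sharp finitely generated torsion-free commutative cancellative monoid with a complete flag of faces {0} = F₀ ⊊ F₁ ⊊ ⋯ ⊊ F_d = P. Then there exists an injective monoid homomorphism φ: P → ℕ^d taking the standard flag of ℕ^d to the given flag via preimage (φ⁻¹(⟨e₁,…,eᵢ⟩) = Fᵢ for all i) and inducing an isomorphism P^gp ≅ ℤ^d. -/
/-- `F` is a face of the monoid `P`: a submonoid of `P` such that `p + p' ∈ F` (for
`p, p' ∈ P`) implies `p ∈ F`. -/
def IsMonoidFace {G : Type*} [AddCommGroup G] (P F : AddSubmonoid G) : Prop :=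
  F ≤ P ∧ ∀ p ∈ P, ∀ q ∈ P, p + q ∈ F → p ∈ F

theorem flagaux_eqLocus {M G : Type*} [AddCommMonoid M] [AddCommGroup G] [AddMonoid.FG M]
    (u v : M →+ G) : (u.eqLocusM v).FG := by
  have : Module.Finite ℕ M := Module.Finite.iff_addMonoid_fg.2 inferInstance
  obtain ⟨n, f, hf⟩ := Module.Finite.exists_fin' ℕ M
  have h := (AddSubmonoid.fg_eqLocusM (u.comp f.toAddMonoidHom) (v.comp f.toAddMonoidHom)).map
    f.toAddMonoidHom
  convert h
  ext m
  constructor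
  · intro hm
    obtain ⟨w, rfl⟩ := hf m
    exact ⟨w, hm, rfl⟩
  · rintro ⟨w, hw, rfl⟩
    exact hw

theorem flagaux_unit {G : Type*} [AddCommGroup G] (P F : AddSubmonoid G)
    (hF : IsMonoidFace P F)
    (hmax : ∀ F' : AddSubmonoid G, IsMonoidFace P F' → F ≤ F' → F' = F ∨ F' = P)
    (z : G) (hz : z ∈ P) (hzF : z ∉ F) (y : G) (hy : y ∈ P) :
    ∃ q ∈ P, ∃ k : ℕ, ∃ f ∈ F, k • z + f = y + q := by
  let E : AddSubmonoid G :=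
    { carrier := {p | p ∈ P ∧ ∃ q ∈ P, ∃ k : ℕ, ∃ f ∈ F, k • z + f = p + q}
      zero_mem' := ⟨P.zero_mem, 0, P.zero_mem, 0, 0, F.zero_mem, by simp⟩
      add_mem' := by
        rintro a b ⟨ha, q, hq, k, f, hf, h⟩ ⟨hb, q', hq', k', f', hf', h'⟩
        refine ⟨P.add_mem ha hb, q + q', P.add_mem hq hq', k + k', f + f', F.add_mem hf hf', ?_⟩
        rw [add_smul]
        calc _ = (k • z + f) + (k' • z + f') := by abel
          _ = _ := by rw [h, h']; abel }
  have hE : IsMonoidFace P E := by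
    refine ⟨fun p hp => hp.1, ?_⟩
    rintro p hp q hq ⟨-, r, hr, k, f, hf, h⟩
    exact ⟨hp, q + r, P.add_mem hq hr, k, f, hf, by rw [h]; abel⟩
  have hzE : z ∈ E := ⟨hz, 0, P.zero_mem, 1, 0, F.zero_mem, by simp⟩
  have hFE : F ≤ E := fun f hf => ⟨hF.1 hf, 0, P.zero_mem, 0, f, hf, by simp⟩
  rcases hmax E hE hFE with h | h
  · exact absurd (h ▸ hzE) hzF
  · have : y ∈ E := h ▸ hy
    exact this.2

theorem flagaux_smul_mem {G : Type*} [AddCommGroup G] (P F : AddSubmonoid G)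
    (hF : IsMonoidFace P F) (b : ℕ) (hb : 0 < b) (y q : G) (hy : y ∈ P) (hq : q ∈ P)
    (h : b • y + q ∈ F) : y ∈ F := by
  obtain ⟨c, rfl⟩ : ∃ c, b = c + 1 := ⟨b - 1, by omega⟩
  refine hF.2 y hy (c • y + q) (P.add_mem (P.nsmul_mem hy c) hq) ?_
  convert h using 1
  rw [add_smul, one_smul]; abel

theorem flagaux_prop {G : Type*} [AddCommGroup G] (P F : AddSubmonoid G)
    (hF : IsMonoidFace P F) (hPfg : P.FG) (hFfg : F.FG)
    (hmax : ∀ F' : AddSubmonoid G, IsMonoidFace P F' → F ≤ F' → F' = F ∨ F' = P)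
    (x : G) (hx : x ∈ P) (hxF : x ∉ F) (y : G) (hy : y ∈ P) (hyF : y ∉ F) :
    ∃ a b : ℕ, 0 < a ∧ 0 < b ∧ ∃ f ∈ F, ∃ f' ∈ F, a • x + f = b • y + f' := by
  have : AddMonoid.FG P := (AddMonoid.fg_iff_addSubmonoid_fg P).2 hPfg
  have : AddMonoid.FG F := (AddMonoid.fg_iff_addSubmonoid_fg F).2 hFfg
  let u : (ℕ × F) × (ℕ × P) →+ G :=
    { toFun := fun m => m.1.1 • x + (m.1.2 : G)
      map_zero' := by simp
      map_add' := by intro m n; simp [add_smul]; abel }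
  let v : (ℕ × F) × (ℕ × P) →+ G :=
    { toFun := fun m => m.2.1 • y + (m.2.2 : G)
      map_zero' := by simp
      map_add' := by intro m n; simp [add_smul]; abel }
  obtain ⟨T, hT⟩ := flagaux_eqLocus u v
  have hTmem : ∀ t ∈ T, t.1.1 • x + (t.1.2 : G) = t.2.1 • y + (t.2.2 : G) := by
    intro t ht
    have : t ∈ u.eqLocusM v := hT ▸ AddSubmonoid.subset_closure ht
    exact this
  have hzero : ∀ t ∈ T, t.1.1 = 0 → t.2.1 = 0 := by
    intro t ht h0
    by_contra hne
    have h := hTmem t ht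
    rw [h0, zero_smul, zero_add] at h
    exact hyF (flagaux_smul_mem P F hF _ (Nat.pos_of_ne_zero hne) y t.2.2 hy t.2.2.2
      (h ▸ t.1.2.2))
  have hlin : ∀ a0 b0 : ℕ, (∀ t ∈ T, t.2.1 * a0 ≤ b0 * t.1.1) →
      ∀ (a b : ℕ), ∀ f ∈ F, ∀ q ∈ P, a • x + f = b • y + q → b * a0 ≤ b0 * a := by
    intro a0 b0 h a b f hf q hq he
    have hm : (((a, ⟨f, hf⟩), (b, ⟨q, hq⟩)) : (ℕ × F) × (ℕ × P)) ∈ 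
        AddSubmonoid.closure (T : Set ((ℕ × F) × (ℕ × P))) := by
      rw [hT]; exact he
    have : ∀ m ∈ AddSubmonoid.closure (T : Set ((ℕ × F) × (ℕ × P))),
        m.2.1 * a0 ≤ b0 * m.1.1 := by
      intro m hm
      induction hm using AddSubmonoid.closure_induction with
      | mem t ht => exact h t ht
      | zero => simp
      | add m n _ _ h1 h2 =>
        simp only [Prod.fst_add, Prod.snd_add]
        nlinarith
    exact this _ hm
  obtain ⟨q1, hq1, k1, f1, hf1, he1⟩ := flagaux_unit P F hF hmax x hx hxF y hy
  have he1' : k1 • x + f1 = 1 • y + q1 := by rw [one_smul, he1]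
  have hne : (T.filter (fun t => 0 < t.1.1)).Nonempty := by
    by_contra hcon
    rw [Finset.not_nonempty_iff_eq_empty, Finset.filter_eq_empty_iff] at hcon
    have := hlin 1 0 (fun t ht => by
      have h1 := hcon ht
      have := hzero t ht (by omega)
      simp [this]) k1 1 f1 hf1 q1 hq1 he1'
    omega
  obtain ⟨t0, ht0, hmaxt⟩ := Finset.exists_max_image _
    (fun t : (ℕ × F) × (ℕ × P) => (t.2.1 : ℚ) / (t.1.1 : ℚ)) hne
  rw [Finset.mem_filter] at ht0
  obtain ⟨ht0, ha0⟩ := ht0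
  have hl := hlin t0.1.1 t0.2.1 (by
    intro t ht
    by_cases h0 : t.1.1 = 0
    · simp [hzero t ht h0]
    · have hp : 0 < t.1.1 := Nat.pos_of_ne_zero h0
      have := hmaxt t (Finset.mem_filter.2 ⟨ht, hp⟩)
      rw [div_le_div_iff₀ (by exact_mod_cast hp) (by exact_mod_cast ha0)] at this
      exact_mod_cast this)
  have hb0 : 0 < t0.2.1 := by
    have := hl k1 1 f1 hf1 q1 hq1 he1'
    by_contra hc
    have h0 : t0.2.1 = 0 := by omega
    rw [h0] at this
    omega
  have he0 := hTmem t0 ht0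
  refine ⟨t0.1.1, t0.2.1, ha0, hb0, t0.1.2, t0.1.2.2, t0.2.2, ?_, he0⟩
  by_contra hq
  obtain ⟨q, hq, k, f, hf, he⟩ := flagaux_unit P F hF hmax _ t0.2.2.2 hq y hy
  have := hl (k * t0.1.1) (k * t0.2.1 + 1) (k • (t0.1.2 : G) + f)
    (F.add_mem (F.nsmul_mem t0.1.2.2 k) hf) q hq (by
      rw [mul_smul, add_smul, mul_smul, one_smul]
      calc _ = k • (t0.1.1 • x + (t0.1.2 : G)) + f := by rw [smul_add]; abel
        _ = k • t0.2.1 • y + (k • (t0.2.2 : G) + f) := by rw [he0, smul_add]; abel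
        _ = _ := by rw [he]; abel)
  nlinarith

theorem flagaux_face_fg {G : Type*} [AddCommGroup G] (P F : AddSubmonoid G)
    (hF : IsMonoidFace P F) (hPfg : P.FG) : F.FG := by
  classical
  obtain ⟨T, hT⟩ := hPfg
  refine ⟨T.filter (· ∈ F), le_antisymm ?_ ?_⟩
  · rw [AddSubmonoid.closure_le]
    intro t ht
    simp at ht
    exact ht.2
  · have : ∀ p ∈ AddSubmonoid.closure (T : Set G), p ∈ F →
        p ∈ AddSubmonoid.closure ((T.filter (· ∈ F) : Finset G) : Set G) := by
      intro p hp
      induction hp using AddSubmonoid.closure_induction with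
      | mem t ht => 
        intro h
        exact AddSubmonoid.subset_closure (by simp; exact ⟨ht, h⟩)
      | zero => intro _; exact zero_mem _
      | add a b ha hb h1 h2 =>
        intro h
        rw [hT] at ha hb
        exact add_mem (h1 (hF.2 a ha b hb h)) (h2 (hF.2 b hb a ha (by rwa [add_comm])))
    intro p hp
    exact this p (hT ▸ hF.1 hp) hp

/-- Saturation of the group generated by `F`. -/
def flagauxSat {G : Type*} [AddCommGroup G] (F : AddSubmonoid G) : AddSubgroup G where
  carrier := {g | ∃ n : ℕ, 0 < n ∧ ∃ p ∈ F, ∃ q ∈ F, n • g = p - q}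
  zero_mem' := ⟨1, one_pos, 0, F.zero_mem, 0, F.zero_mem, by simp⟩
  add_mem' := by
    rintro a b ⟨n, hn, p, hp, q, hq, h⟩ ⟨n', hn', p', hp', q', hq', h'⟩
    refine ⟨n * n', Nat.mul_pos hn hn', n' • p + n • p',
      F.add_mem (F.nsmul_mem hp _) (F.nsmul_mem hp' _), n' • q + n • q',
      F.add_mem (F.nsmul_mem hq _) (F.nsmul_mem hq' _), ?_⟩
    calc (n * n') • (a + b) = n' • (n • a) + n • (n' • b) := by
          rw [smul_smul, smul_smul, smul_add, mul_comm n n']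
      _ = _ := by rw [h, h', smul_sub, smul_sub]; abel
  neg_mem' := by
    rintro a ⟨n, hn, p, hp, q, hq, h⟩
    exact ⟨n, hn, q, hq, p, hp, by rw [smul_neg, h]; abel⟩

theorem flagaux_sat_sat {G : Type*} [AddCommGroup G] (F : AddSubmonoid G) (n : ℕ) (hn : 0 < n)
    (g : G) (h : n • g ∈ flagauxSat F) : g ∈ flagauxSat F := by
  obtain ⟨m, hm, p, hp, q, hq, h⟩ := h
  exact ⟨m * n, Nat.mul_pos hm hn, p, hp, q, hq, by rw [mul_smul, h]⟩

theorem flagaux_le_sat {G : Type*} [AddCommGroup G] (F : AddSubmonoid G) (g : G) (h : g ∈ F) :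
    g ∈ flagauxSat F :=
  ⟨1, one_pos, g, h, 0, F.zero_mem, by simp⟩

theorem flagaux_sat_inter {G : Type*} [AddCommGroup G] (P F : AddSubmonoid G)
    (hF : IsMonoidFace P F) (g : G) (hg : g ∈ P) (h : g ∈ flagauxSat F) : g ∈ F := by
  obtain ⟨m, hm, p, hp, q, hq, h⟩ := h
  refine flagaux_smul_mem P F hF m hm g q hg (hF.1 hq) ?_
  rw [h, sub_add_cancel]; exact hp

/-- The functional cutting out a maximal face. -/
theorem flagaux_functional {G : Type*} [AddCommGroup G] [Module.Finite ℤ G]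
    (P F : AddSubmonoid G)
    (hF : IsMonoidFace P F) (hPfg : P.FG)
    (hgen : ∀ g : G, ∃ n : ℕ, 0 < n ∧ ∃ p ∈ P, ∃ q ∈ P, n • g = p - q)
    (hne : F < P)
    (hmax : ∀ F' : AddSubmonoid G, IsMonoidFace P F' → F ≤ F' → F' = F ∨ F' = P) :
    ∃ ψ : G →+ ℤ, (∃ e, ψ e = 1) ∧ (∀ g, ψ g = 0 ↔ g ∈ flagauxSat F) ∧
      (∀ p ∈ P, p ∉ F → 0 < ψ p) := by
  have hFfg := flagaux_face_fg P F hF hPfg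
  obtain ⟨x, hx, hxF⟩ := SetLike.exists_of_lt hne
  have hprop : ∀ y ∈ P, ∃ n : ℕ, 0 < n ∧ ∃ m : ℕ, (y ∉ F → 0 < m) ∧
      n • y - m • x ∈ flagauxSat F := by
    intro y hy
    by_cases hyF : y ∈ F
    · exact ⟨1, one_pos, 0, fun h => absurd hyF h, by
        simpa using flagaux_le_sat F y hyF⟩
    · obtain ⟨a, b, ha, hb, f, hf, f', hf', he⟩ :=
        flagaux_prop P F hF hPfg hFfg hmax x hx hxF y hy hyF
      refine ⟨b, hb, a, fun _ => ha, ?_⟩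
      have : b • y - a • x = f - f' := by
        rw [sub_eq_sub_iff_add_eq_add, ← he]; abel
      rw [this]
      exact sub_mem (flagaux_le_sat F f hf) (flagaux_le_sat F f' hf')
  have hpropG : ∀ g : G, ∃ n : ℕ, 0 < n ∧ ∃ m : ℤ, n • g - m • x ∈ flagauxSat F := by
    intro g
    obtain ⟨n, hn, p, hp, q, hq, h⟩ := hgen g
    obtain ⟨n1, hn1, m1, -, h1⟩ := hprop p hp
    obtain ⟨n2, hn2, m2, -, h2⟩ := hprop q hq
    refine ⟨n1 * n2 * n, by positivity, (n2 : ℤ) * m1 - n1 * m2, ?_⟩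
    have : (n1 * n2 * n) • g - ((n2 : ℤ) * m1 - n1 * m2) • x
        = n2 • (n1 • p - m1 • x) - n1 • (n2 • q - m2 • x) := by
      rw [mul_smul, h]
      module
    rw [this]
    exact sub_mem (nsmul_mem h1 _) (nsmul_mem h2 _)
  let H : Submodule ℤ G := AddSubgroup.toIntSubmodule (flagauxSat F)
  have hH : ∀ g, g ∈ H ↔ g ∈ flagauxSat F := fun g => Iff.rfl
  have : Module.IsTorsionFree ℤ (G ⧸ H) := by
    rw [Module.isTorsionFree_int_iff_isAddTorsionFree]
    refine ⟨fun n hn a b hab => ?_⟩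
    obtain ⟨a, rfl⟩ := H.mkQ_surjective a
    obtain ⟨b, rfl⟩ := H.mkQ_surjective b
    simp only [← map_nsmul] at hab
    rw [← sub_eq_zero, ← map_sub, Submodule.mkQ_apply, Submodule.Quotient.mk_eq_zero, hH,
      ← smul_sub] at hab
    rw [← sub_eq_zero, ← map_sub, Submodule.mkQ_apply, Submodule.Quotient.mk_eq_zero, hH]
    exact flagaux_sat_sat F n (Nat.pos_of_ne_zero hn) _ hab
  let B := Module.Free.chooseBasis ℤ (G ⧸ H)
  have hx0 : H.mkQ x ≠ 0 := by
    intro h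
    rw [Submodule.mkQ_apply, Submodule.Quotient.mk_eq_zero, hH] at h
    exact hxF (flagaux_sat_inter P F hF x hx h)
  obtain ⟨i, hi⟩ : ∃ i, B.coord i (H.mkQ x) ≠ 0 := by
    by_contra hcon
    push Not at hcon
    exact hx0 ((B.forall_coord_eq_zero_iff).1 hcon)
  let ψ0 : G →+ ℤ := ((B.coord i).comp H.mkQ).toAddMonoidHom
  have hψ0x : ψ0 x ≠ 0 := hi
  have hψ0H : ∀ g, g ∈ flagauxSat F → ψ0 g = 0 := by
    intro g hg
    have : H.mkQ g = 0 := by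
      rw [Submodule.mkQ_apply, Submodule.Quotient.mk_eq_zero]; exact hg
    change B.coord i (H.mkQ g) = 0
    rw [this, map_zero]
  have hψ0ker : ∀ g, ψ0 g = 0 ↔ g ∈ flagauxSat F := by
    refine fun g => ⟨fun h => ?_, hψ0H g⟩
    obtain ⟨n, hn, m, hm⟩ := hpropG g
    have h1 := hψ0H _ hm
    rw [map_sub, map_nsmul, map_zsmul, h, smul_zero, zero_sub, neg_eq_zero, smul_eq_mul] at h1
    have hm0 : m = 0 := by
      rcases mul_eq_zero.1 h1 with h | h
      · exact h
      · exact absurd h hψ0x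
    rw [hm0, zero_smul, sub_zero] at hm
    exact flagaux_sat_sat F n hn g hm
  obtain ⟨e0, he0⟩ : ∃ e, ψ0 e = 1 := by
    obtain ⟨e, he⟩ := H.mkQ_surjective (B i)
    refine ⟨e, ?_⟩
    change B.coord i (H.mkQ e) = 1
    rw [he]; simp
  have key : ∃ ψ : G →+ ℤ, (∃ e, ψ e = 1) ∧ (∀ g, ψ g = 0 ↔ g ∈ flagauxSat F) ∧ 0 < ψ x := by
    rcases lt_or_gt_of_ne hψ0x with h | h
    · exact ⟨-ψ0, ⟨-e0, by simp [he0]⟩, fun g => by simp [hψ0ker], by simpa using h⟩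
    · exact ⟨ψ0, ⟨e0, he0⟩, hψ0ker, h⟩
  obtain ⟨ψ, he, hker, hpos⟩ := key
  refine ⟨ψ, he, hker, fun p hp hpF => ?_⟩
  obtain ⟨n, hn, m, hm, h⟩ := hprop p hp
  have h1 := (hker _).2 h
  have hm' := hm hpF
  rw [map_sub, map_nsmul, map_nsmul, sub_eq_zero, nsmul_eq_mul, nsmul_eq_mul] at h1
  have h2 : 0 < (m : ℤ) * ψ x := mul_pos (by exact_mod_cast hm') hpos
  rw [← h1] at h2
  exact pos_of_mul_pos_right h2 (by positivity)

theorem flagaux_main.{u} (d : ℕ) : ∀ {G : Type u} [AddCommGroup G] [Module.Finite ℤ G]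
    (P : AddSubmonoid G) (_ : P.FG)
    (_ : ∀ g : G, ∃ n : ℕ, 0 < n ∧ ∃ p ∈ P, ∃ q ∈ P, n • g = p - q)
    (_ : ∀ (n : ℕ) (g : G), 0 < n → n • g = 0 → g = 0)
    (F : Fin (d + 1) → AddSubmonoid G)
    (_ : ∀ i, IsMonoidFace P (F i))
    (_ : StrictMono F)
    (_ : F 0 = ⊥) (_ : F (Fin.last d) = P)
    (_ : ∀ (i : Fin d) (F' : AddSubmonoid G), IsMonoidFace P F' →
      F i.castSucc ≤ F' → F' ≤ F i.succ → F' = F i.castSucc ∨ F' = F i.succ),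
    ∃ φ : G →+ (Fin d → ℤ), Function.Bijective φ ∧
      (∀ p ∈ P, ∀ j : Fin d, 0 ≤ φ p j) ∧
      (∀ (i : Fin (d + 1)), ∀ p ∈ P,
        (p ∈ F i ↔ ∀ j : Fin d, (i : ℕ) ≤ (j : ℕ) → φ p j = 0)) := by
  induction d with
  | zero =>
    intro G _ _ P hfg hgen htf F hface hmono h0 htop hcomplete
    have hP : P = ⊥ := by rw [← htop, ← h0]; rfl
    have hG : ∀ g : G, g = 0 := by
      intro g
      obtain ⟨n, hn, p, hp, q, hq, h⟩ := hgen g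
      rw [hP, AddSubmonoid.mem_bot] at hp hq
      exact htf n g hn (by rw [h, hp, hq, sub_zero])
    refine ⟨0, ⟨fun a b _ => by rw [hG a, hG b], fun v => ⟨0, Subsingleton.elim _ _⟩⟩,
      fun p _ j => j.elim0, fun i p hp => ⟨fun _ j => j.elim0, fun _ => ?_⟩⟩
    rw [hG p]; exact zero_mem _
  | succ d ih =>
    intro G _ _ P hfg hgen htf F hface hmono h0 htop hcomplete
    let K := F (Fin.last d).castSucc
    have hK : IsMonoidFace P K := hface _
    have hFK : ∀ i : Fin (d + 1), F i.castSucc ≤ K := fun i =>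
      hmono.monotone (Fin.castSucc_le_castSucc_iff.2 (Fin.le_last i))
    have hlt : K < P := by
      have : K < F (Fin.last (d + 1)) := hmono (Fin.castSucc_lt_last _)
      rwa [htop] at this
    have hKfg := flagaux_face_fg P K hK hfg
    obtain ⟨ψ, ⟨e, he⟩, hker, hpos⟩ := flagaux_functional P K hK hfg hgen hlt (by
      intro F' hF' hle
      have := hcomplete (Fin.last d) F' hF' hle (by rw [Fin.succ_last, htop]; exact hF'.1)
      rwa [Fin.succ_last, htop] at this)
    let H := flagauxSat K
    have hKH : ∀ g, g ∈ K → g ∈ H := flagaux_le_sat K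
    have : Module.Finite ℤ H :=
      inferInstanceAs (Module.Finite ℤ (AddSubgroup.toIntSubmodule H))
    have hKψ : ∀ p ∈ P, (p ∈ K ↔ ψ p = 0) := fun p hp =>
      ⟨fun h => (hker p).2 (hKH p h), fun h => flagaux_sat_inter P K hK p hp ((hker p).1 h)⟩
    have hmapc : ∀ A : AddSubmonoid G, A ≤ K → (A.comap H.subtype).map H.subtype = A := by
      intro A hA
      apply le_antisymm
      · rintro _ ⟨a, ha, rfl⟩; exact ha
      · intro a ha; exact ⟨⟨a, hKH a (hA ha)⟩, ha, rfl⟩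
    obtain ⟨φ, hbij, hnn, hflag⟩ := ih (G := H) (K.comap H.subtype)
      (AddSubmonoid.FG.map_injective H.subtype H.subtype_injective
        (by rw [hmapc K le_rfl]; exact hKfg))
      (by
        rintro ⟨g, n, hn, p, hp, q, hq, h⟩
        exact ⟨n, hn, ⟨p, hKH p hp⟩, hp, ⟨q, hKH q hq⟩, hq, Subtype.ext h⟩)
      (fun n g hn h => Subtype.ext (htf n g hn (by simpa using congrArg Subtype.val h)))
      (fun i => (F i.castSucc).comap H.subtype)
      (fun i => ⟨fun a ha => hFK i ha, fun p hp q hq h =>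
        (hface i.castSucc).2 p (hK.1 hp) q (hK.1 hq) h⟩)
      (by
        intro i j hij
        have h := hmono (Fin.castSucc_lt_castSucc_iff.2 hij)
        refine lt_of_le_of_ne (fun a ha => h.le ha) (fun heq => h.ne ?_)
        have := congrArg (AddSubmonoid.map H.subtype) heq
        simpa only [hmapc _ (hFK _)] using this)
      (by
        rw [eq_bot_iff]
        intro a ha
        have : (a : G) ∈ F 0 := ha
        rw [h0, AddSubmonoid.mem_bot] at this
        exact Subtype.ext this)
      rfl
      (by
        intro i F' hF' h1 h2
        have hle : F'.map H.subtype ≤ K := by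
          rintro _ ⟨a, ha, rfl⟩; exact hF'.1 ha
        have hf : IsMonoidFace P (F'.map H.subtype) := by
          refine ⟨hle.trans hK.1, fun p hp q hq h => ?_⟩
          have hpK := hK.2 p hp q hq (hle h)
          have hqK := hK.2 q hq p hp (by rw [add_comm]; exact hle h)
          obtain ⟨a, ha, hab⟩ := h
          refine ⟨⟨p, hKH p hpK⟩, hF'.2 _ hpK ⟨q, hKH q hqK⟩ hqK ?_, rfl⟩
          have hae : (⟨p, hKH p hpK⟩ : H) + ⟨q, hKH q hqK⟩ = a := Subtype.ext hab.symm
          rw [hae]; exact ha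
        have hc : (F'.map H.subtype).comap H.subtype = F' :=
          AddSubmonoid.comap_map_eq_of_injective H.subtype_injective F'
        rcases hcomplete i.castSucc _ hf
          (by
            intro a ha
            exact ⟨⟨a, hKH a (hFK _ ha)⟩, h1 ha, rfl⟩)
          (by
            rintro _ ⟨a, ha, rfl⟩; exact h2 ha) with h | h
        · left; rw [← hc, h]
        · right; rw [← hc, h]; rfl)
    -- projection to `H` along `e`
    let π : G →+ H :=
      { toFun := fun g => ⟨g - ψ g • e, (hker _).1 (by simp [he])⟩
        map_zero' := by ext; simp
        map_add' := by intro a b; ext; simp [add_smul]; abel }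
    have hπ : ∀ g, ψ g = 0 → (π g : G) = g := by
      intro g hg; change g - ψ g • e = g; simp [hg]
    obtain ⟨T, hT⟩ := hfg
    have hTP : ∀ t ∈ T, t ∈ P := fun t ht => hT ▸ AddSubmonoid.subset_closure ht
    let N : ℤ := ∑ t ∈ T, ∑ j, |φ (π t) j|
    have hN : ∀ t ∈ T, ∀ j, |φ (π t) j| ≤ N := by
      intro t ht j
      calc |φ (π t) j| ≤ ∑ j, |φ (π t) j| :=
            Finset.single_le_sum (f := fun j => |φ (π t) j|) (fun _ _ => abs_nonneg _)
              (Finset.mem_univ j)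
        _ ≤ N := Finset.single_le_sum (f := fun t => ∑ j, |φ (π t) j|)
            (fun _ _ => Finset.sum_nonneg fun _ _ => abs_nonneg _) ht
    let Φ : G →+ (Fin (d + 1) → ℤ) :=
      { toFun := fun g => Fin.snoc (α := fun _ => ℤ) (fun j => φ (π g) j + N * ψ g) (ψ g)
        map_zero' := by
          ext j
          refine Fin.lastCases ?_ (fun j => ?_) j <;> simp
        map_add' := by
          intro a b
          ext j
          refine Fin.lastCases ?_ (fun j => ?_) j
          · simp
          · simp; ring }
    have hΦl : ∀ g, Φ g (Fin.last d) = ψ g := by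
      intro g; simp [Φ]
    have hΦc : ∀ g (j : Fin d), Φ g j.castSucc = φ (π g) j + N * ψ g := by
      intro g j; simp [Φ]
    refine ⟨Φ, ⟨?_, ?_⟩, ?_, ?_⟩
    · rw [injective_iff_map_eq_zero]
      intro g hg
      have h1 : ψ g = 0 := by rw [← hΦl, hg]; rfl
      have h2 : φ (π g) = 0 := by
        ext j
        have := hΦc g j
        rw [hg, h1] at this
        simpa using this.symm
      have h3 : π g = 0 := (injective_iff_map_eq_zero φ).1 hbij.1 _ h2
      rw [← hπ g h1, h3]; rfl
    · intro v
      obtain ⟨s, hs⟩ := hbij.2 (fun j => v j.castSucc - N * v (Fin.last d))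
      have hs0 : ψ s = 0 := (hker _).2 s.2
      have hψ : ψ (s + v (Fin.last d) • e) = v (Fin.last d) := by simp [hs0, he]
      have hπs : π (s + v (Fin.last d) • e) = s := by
        apply Subtype.ext
        change (s + v (Fin.last d) • e : G) - ψ (s + v (Fin.last d) • e) • e = s
        rw [hψ]; abel
      refine ⟨s + v (Fin.last d) • e, ?_⟩
      ext j
      refine Fin.lastCases ?_ (fun j => ?_) j
      · rw [hΦl, hψ]
      · rw [hΦc, hψ, hπs, hs]; ring
    · have hT0 : ∀ t ∈ T, ∀ j, 0 ≤ Φ t j := by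
        intro t ht j
        by_cases htK : t ∈ K
        · have h0 := (hKψ t (hTP t ht)).1 htK
          refine Fin.lastCases ?_ (fun j => ?_) j
          · rw [hΦl, h0]
          · rw [hΦc, h0, mul_zero, add_zero]
            refine hnn _ ?_ j
            change (π t : G) ∈ K
            rw [hπ t h0]; exact htK
        · have h0 := hpos t (hTP t ht) htK
          refine Fin.lastCases ?_ (fun j => ?_) j
          · rw [hΦl]; exact h0.le
          · rw [hΦc]
            have h1 := hN t ht j
            have h2 := neg_abs_le (φ (π t) j)
            have h3 : 0 ≤ N := (abs_nonneg _).trans h1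
            nlinarith
      intro p hp
      rw [← hT] at hp
      induction hp using AddSubmonoid.closure_induction with
      | mem t ht => exact hT0 t ht
      | zero => intro j; simp
      | add a b _ _ h1 h2 => intro j; rw [map_add]; exact add_nonneg (h1 j) (h2 j)
    · intro i p hp
      refine Fin.lastCases ?_ (fun i => ?_) i
      · rw [htop]
        refine ⟨fun _ j hj => ?_, fun _ => hp⟩
        have := j.2
        simp at hj
        omega
      · constructor
        · intro h j hj
          have hpK := hFK i h
          have h0 := (hKψ p hp).1 hpK
          have h1 := (hflag i (π p) (by change (π p : G) ∈ K; rw [hπ p h0]; exact hpK)).1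
            (by change (π p : G) ∈ F i.castSucc; rw [hπ p h0]; exact h)
          revert hj
          refine Fin.lastCases ?_ (fun j => ?_) j
          · intro _; rw [hΦl, h0]
          · intro hj; rw [hΦc, h0, h1 j (by simpa using hj)]; simp
        · intro h
          have h0 : ψ p = 0 := by
            rw [← hΦl]; exact h _ (by simp; omega)
          have hpK := (hKψ p hp).2 h0
          have h1 := (hflag i (π p) (by change (π p : G) ∈ K; rw [hπ p h0]; exact hpK)).2 (by
            intro j hj
            have := h j.castSucc (by simpa using hj)
            rw [hΦc, h0] at this
            simpa using this)
          change (π p : G) ∈ F i.castSucc at h1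
          rwa [hπ p h0] at h1

/-- Let `P` be a sharp, finitely generated, torsion-free, commutative cancellative monoid
(realized as a submonoid of its Grothendieck group `G`), equipped with a complete flag of
faces `{0} = F₀ ⊊ F₁ ⊊ ⋯ ⊊ F_d = P`.  Then there is an injective monoid homomorphism
`φ : P → ℕ^d` (realized as a group homomorphism `G → ℤ^d` mapping `P` into `ℕ^d`)
inducing an isomorphism `P^gp ≅ ℤ^d` and taking the standard flag of `ℕ^d` to the given
flag via preimage: `p ∈ Fᵢ ↔ φ(p)ⱼ = 0 for all j ≥ i`. -/
theorem exists_flag_embedding {G : Type*} [AddCommGroup G] (P : AddSubmonoid G)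
    (hfg : P.FG)
    (hgen : ∀ g : G, ∃ p ∈ P, ∃ q ∈ P, g = p - q)
    (hsharp : ∀ g ∈ P, -g ∈ P → g = 0)
    (htf : ∀ (n : ℕ) (g : G), 0 < n → n • g = 0 → g = 0)
    (d : ℕ) (F : Fin (d + 1) → AddSubmonoid G)
    (hface : ∀ i, IsMonoidFace P (F i))
    (hmono : StrictMono F)
    (h0 : F 0 = ⊥) (htop : F (Fin.last d) = P)
    (hcomplete : ∀ (i : Fin d) (F' : AddSubmonoid G), IsMonoidFace P F' →
      F i.castSucc ≤ F' → F' ≤ F i.succ → F' = F i.castSucc ∨ F' = F i.succ) :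
    ∃ φ : G →+ (Fin d → ℤ), Function.Bijective φ ∧
      (∀ p ∈ P, ∀ j : Fin d, 0 ≤ φ p j) ∧
      (∀ (i : Fin (d + 1)), ∀ p ∈ P,
        (p ∈ F i ↔ ∀ j : Fin d, (i : ℕ) ≤ (j : ℕ) → φ p j = 0)) := by
  have : Module.Finite ℤ G := by
    obtain ⟨T, hT⟩ := hfg
    refine ⟨⟨T, ?_⟩⟩
    rw [eq_top_iff]
    have hP : ∀ p ∈ P, p ∈ Submodule.span ℤ (T : Set G) := by
      intro p hp
      rw [← hT] at hp
      have : AddSubmonoid.closure (T : Set G) ≤ (Submodule.span ℤ (T : Set G)).toAddSubmonoid :=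
        AddSubmonoid.closure_le.2 Submodule.subset_span
      exact this hp
    intro g _
    obtain ⟨p, hp, q, hq, rfl⟩ := hgen g
    exact sub_mem (hP p hp) (hP q hq)
  exact flagaux_main d P hfg (fun g => by
    obtain ⟨p, hp, q, hq, h⟩ := hgen g
    exact ⟨1, one_pos, p, hp, q, hq, by rw [one_smul, h]⟩) htf F hface hmono h0 htop hcomplete
end
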